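/- For the model dX(t)=σ X(t) db_H(t)+μ X(t) dt, X(0)=c (so X(t)=c exp(μt+σ b_H(t)) for t≥0, X(t)=c for t<0), one has for 0≤t≤1 the decomposition Ẍ_ε(t) = σ X_ε(t) b̈_H^ε(t) + X_ε(t) a_ε(t), where for every δ>0, almost surely there exist C(ω)>0 and ε_0(ω)>0 such that for all 0<ε≤ε_0 and all t∈[0,1], X_ε(t)≠0 and |a_ε(t)| ≤ C(ω)(ε^{H−2−δ} 1_{{0≤t≤ε}} + ε^{2H−2−δ} 1_{{ε≤t≤1}}). -/

import Mathlib

open MeasureTheory ProbabilityTheory Filter Topology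
open scoped FourierTransform

noncomputable section

namespace FBMPaper

variable {Ω : Type} [MeasurableSpace Ω]

/-- The constant `v_{2H}²  = (Γ(2H+1) sin(πH))⁻¹`. -/
def v2Hsq (H : ℝ) : ℝ := (Real.Gamma (2 * H + 1) * Real.sin (Real.pi * H))⁻¹

/-- Covariance function of fractional Brownian motion with Hurst parameter `H`. -/
def fbmCov (H s t : ℝ) : ℝ :=
  (1 / 2) * v2Hsq H * (|t| ^ (2 * H) + |s| ^ (2 * H) - |t - s| ^ (2 * H))

/-- `bH` is a fractional Brownian motion with Hurst parameter `H` under `P`: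
a centered Gaussian process with the fBm covariance, with almost surely continuous
sample paths which are locally `(H - δ)`-Hölder continuous for every `δ > 0`. -/
structure IsFBM (P : Measure Ω) (H : ℝ) (bH : ℝ → Ω → ℝ) : Prop where
  measurable : ∀ t, Measurable (bH t)
  gaussian : ∀ (n : ℕ) (t a : Fin n → ℝ), ∃ v : NNReal,
    P.map (fun ω => ∑ i, a i * bH (t i) ω) = gaussianReal 0 v
  covariance : ∀ s t, ∫ ω, bH s ω * bH t ω ∂P = fbmCov H s t
  cont : ∀ᵐ ω ∂P, Continuous fun t => bH t ω
  holder : ∀ δ, 0 < δ → δ < H → ∀ᵐ ω ∂P, ∀ R, 0 < R → ∃ C, 0 < C ∧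
    ∀ s ∈ Set.Icc (-R) R, ∀ t ∈ Set.Icc (-R) R,
      |bH t ω - bH s ω| ≤ C * |t - s| ^ (H - δ)

/-- `φ` is a `C²` probability density with compact support contained in `[-1,1]`. -/
structure IsKernel (φ : ℝ → ℝ) : Prop where
  smooth : ContDiff ℝ 2 φ
  nonneg : ∀ x, 0 ≤ φ x
  integral_one : ∫ x, φ x = 1
  support : Function.support φ ⊆ Set.Icc (-1) 1

/-- Smoothing by convolution: `(φ_ε * f)(t) = ε⁻¹ ∫ φ((t-x)/ε) f(x) dx`. -/
def mollify (φ : ℝ → ℝ) (ε : ℝ) (f : ℝ → ℝ) (t : ℝ) : ℝ :=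
  ε⁻¹ * ∫ x, φ ((t - x) / ε) * f x

/-- second derivative -/
def dd (f : ℝ → ℝ) : ℝ → ℝ := deriv (deriv f)

/-- `φ` seen as a complex valued function. -/
def phiC (φ : ℝ → ℝ) : ℝ → ℂ := fun x => (φ x : ℂ)

/-- `σ_{2H}² = (2π)⁻¹ ∫ |x|^{3-2H} |φ̂(-x)|² dx`. -/
def sigma2Hsq (φ : ℝ → ℝ) (H : ℝ) : ℝ :=
  (2 * Real.pi)⁻¹ * ∫ x : ℝ, |x| ^ (3 - 2 * H) * ‖𝓕 (phiC φ) (-x)‖ ^ 2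

def sigma2H (φ : ℝ → ℝ) (H : ℝ) : ℝ := Real.sqrt (sigma2Hsq φ H)

/-- `σ̃_{2H}² = (2π)⁻¹ ∫ |x|^{1-2H} |φ̂(-x)|² dx`. -/
def sigma2HtildeSq (φ : ℝ → ℝ) (H : ℝ) : ℝ :=
  (2 * Real.pi)⁻¹ * ∫ x : ℝ, |x| ^ (1 - 2 * H) * ‖𝓕 (phiC φ) (-x)‖ ^ 2

def sigma2Htilde (φ : ℝ → ℝ) (H : ℝ) : ℝ := Real.sqrt (sigma2HtildeSq φ H)

/-- `Z_ε(t) = ε^{2-H} b̈_H^ε(t) / σ_{2H}` (for a general underlying process). -/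
def Zeps (φ : ℝ → ℝ) (H : ℝ) (b : ℝ → Ω → ℝ) (ε : ℝ) (ω : Ω) (t : ℝ) : ℝ :=
  ε ^ (2 - H) * dd (mollify φ ε fun s => b s ω) t / sigma2H φ H

/-- Absolute moment `E|N|^k` of a standard Gaussian random variable. -/
def gaussAbsMoment (k : ℝ) : ℝ := ∫ x, |x| ^ k ∂(gaussianReal 0 1)

/-- `n`-th Hermite coefficient `ĝ_n = (n!)⁻¹ ∫ g(x) H_n(x) ϕ(x) dx`. -/
def hermiteCoeff (g : ℝ → ℝ) (n : ℕ) : ℝ :=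
  ((Nat.factorial n : ℝ))⁻¹ * ∫ x, g x * (Polynomial.aeval x (Polynomial.hermite n)) ∂(gaussianReal 0 1)

/-- `S_g(ε) = ε^{-1/2} ∫_0^1 g(Z_ε(u)) du`. -/
def Sg (φ : ℝ → ℝ) (H : ℝ) (b : ℝ → Ω → ℝ) (g : ℝ → ℝ) (ε : ℝ) (ω : Ω) : ℝ :=
  ε ^ (-(1 / 2 : ℝ)) * ∫ u in (0:ℝ)..1, g (Zeps φ H b ε ω u)

/-- `ρ_H(x,b,c)`: the correlation kernel at two scales. -/
def rhoH2 (φ : ℝ → ℝ) (H b c x : ℝ) : ℝ :=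
  ((b * c) ^ (2 - H) / (2 * Real.pi * sigma2Hsq φ H)) *
    (∫ y : ℝ, ((|y| ^ (3 - 2 * H) : ℝ) : ℂ) *
      (Complex.exp (Complex.I * ((x * y : ℝ) : ℂ)) *
        𝓕 (phiC φ) (-(b * y)) * 𝓕 (phiC φ) (c * y))).re

/-- `ρ_g(b,c) = (bc)^{-1/2} Σ_{n≥1} ĝ_n² n! ∫ ρ_H(x,b,c)^n dx`. -/
def rhoG (φ : ℝ → ℝ) (H : ℝ) (g : ℝ → ℝ) (b c : ℝ) : ℝ :=
  (b * c) ^ (-(1 / 2 : ℝ)) * ∑' n : ℕ,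
    (hermiteCoeff g (n + 1)) ^ 2 * (Nat.factorial (n + 1) : ℝ) * ∫ x : ℝ, (rhoH2 φ H b c x) ^ (n + 1)

/-- `ρ_H(x)`, the one-scale correlation function (second-derivative case). -/
def rhoH1 (φ : ℝ → ℝ) (H x : ℝ) : ℝ :=
  (2 * Real.pi * sigma2Hsq φ H)⁻¹ *
    (∫ y : ℝ, ((|y| ^ (3 - 2 * H) : ℝ) : ℂ) *
      (Complex.exp (Complex.I * ((x * y : ℝ) : ℂ)) * ((‖𝓕 (phiC φ) (-y)‖ ^ 2 : ℝ) : ℂ))).re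

/-- `ρ̄_H(x)`, the one-scale correlation function (first-derivative case). -/
def rhoH1tilde (φ : ℝ → ℝ) (H x : ℝ) : ℝ :=
  (2 * Real.pi * sigma2HtildeSq φ H)⁻¹ *
    (∫ y : ℝ, ((|y| ^ (1 - 2 * H) : ℝ) : ℂ) *
      (Complex.exp (Complex.I * ((x * y : ℝ) : ℂ)) * ((‖𝓕 (phiC φ) (-y)‖ ^ 2 : ℝ) : ℂ))).re

/-- `σ_g² = Σ_{n≥1} ĝ_n² n! ∫ ρ(x)^n dx` for a correlation function `ρ`. -/
def sigmaGsq (g : ℝ → ℝ) (ρ : ℝ → ℝ) : ℝ :=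
  ∑' n : ℕ, (hermiteCoeff g (n + 1)) ^ 2 * (Nat.factorial (n + 1) : ℝ) * ∫ x : ℝ, (ρ x) ^ (n + 1)

/-- the function `g_k(x) = |x|^k / E|N|^k - 1`. -/
def gk (k : ℝ) (x : ℝ) : ℝ := |x| ^ k / gaussAbsMoment k - 1

/-- the function `g_1(x) = √(π/2)|x| - 1`. -/
def g1 (x : ℝ) : ℝ := Real.sqrt (Real.pi / 2) * |x| - 1


lemma integrable_kernel_mul {ψ f : ℝ → ℝ} (hψ : Continuous ψ)
    (hsupp : Function.support ψ ⊆ Set.Icc (-1) 1) (hf : Continuous f) :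
    Integrable fun y => ψ y * f y := by
  have hc : HasCompactSupport ψ := .of_support_subset_isCompact isCompact_Icc hsupp
  exact (hψ.mul hf).integrable_of_hasCompactSupport hc.mul_right

lemma abs_integral_kernel_mul_le {ψ f : ℝ → ℝ} {M : ℝ} (hψ : Continuous ψ)
    (hsupp : Function.support ψ ⊆ Set.Icc (-1) 1) (hM : ∀ y ∈ Set.Icc (-1 : ℝ) 1, |f y| ≤ M) :
    |∫ y, ψ y * f y| ≤ (∫ y, |ψ y|) * M := by
  have hc : HasCompactSupport ψ := .of_support_subset_isCompact isCompact_Icc hsupp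
  rw [← integral_mul_const, ← Real.norm_eq_abs]
  refine norm_integral_le_of_norm_le
    ((hψ.integrable_of_hasCompactSupport hc).abs.mul_const M) (.of_forall fun y => ?_)
  rw [Real.norm_eq_abs, abs_mul]
  by_cases hy : ψ y = 0
  · simp [hy]
  · exact mul_le_mul_of_nonneg_left (hM y (hsupp hy)) (abs_nonneg _)

lemma mollify_eq_integral {ε : ℝ} (hε : 0 < ε) (ψ f : ℝ → ℝ) (t : ℝ) :
    mollify ψ ε f t = ∫ y, ψ y * f (t - ε * y) := by
  have h1 : ∫ x, ψ ((t - x) / ε) * f x = ∫ x, ψ (x / ε) * f (t - ε * (x / ε)) := by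
    rw [← integral_sub_left_eq_self _ volume t]
    refine integral_congr_ae (.of_forall fun x => ?_)
    simp only [mul_div_cancel₀ x hε.ne', sub_sub_cancel]
  rw [mollify, h1, Measure.integral_comp_div (fun y => ψ y * f (t - ε * y)), abs_of_pos hε,
    smul_eq_mul, inv_mul_cancel_left₀ hε.ne']

lemma deriv_mollify {ψ f : ℝ → ℝ} {ε : ℝ} (hε : 0 < ε) (hψ : ContDiff ℝ 1 ψ)
    (hc : HasCompactSupport ψ) (hf : Continuous f) :
    deriv (mollify ψ ε f) = fun t => ε⁻¹ * mollify (deriv ψ) ε f t := by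
  set g : ℝ → ℝ := fun x => ψ (ε⁻¹ * x)
  have hg : ContDiff ℝ 1 g := hψ.comp (contDiff_const.mul contDiff_id)
  have hgc : HasCompactSupport g :=
    hc.comp_homeomorph (Homeomorph.mulLeft₀ ε⁻¹ (inv_ne_zero hε.ne'))
  have hdg : deriv g = fun x => ε⁻¹ * deriv ψ (ε⁻¹ * x) := by
    funext x
    simpa using deriv_comp_mul_left ε⁻¹ ψ x
  have hconv : mollify ψ ε f
      = fun t => ε⁻¹ * convolution f g (ContinuousLinearMap.mul ℝ ℝ) volume t := by
    funext t
    simp only [mollify, convolution, g, ContinuousLinearMap.mul_apply', div_eq_inv_mul, mul_comm]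
  funext t
  have hd := (hgc.hasDerivAt_convolution_right (μ := volume) (ContinuousLinearMap.mul ℝ ℝ)
    hf.locallyIntegrable hg t).const_mul ε⁻¹
  rw [hconv, hd.deriv, hdg]
  simp only [mollify, convolution, ContinuousLinearMap.mul_apply', div_eq_inv_mul]
  congr 1
  rw [← integral_const_mul]
  congr 1
  funext x
  ring

lemma support_deriv_subset_Icc {ψ : ℝ → ℝ} (h : Function.support ψ ⊆ Set.Icc (-1) 1) :
    Function.support (deriv ψ) ⊆ Set.Icc (-1) 1 :=
  support_deriv_subset.trans (closure_minimal h isClosed_Icc)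

namespace IsKernel

variable {φ : ℝ → ℝ}

lemma hasCompactSupport (hφ : IsKernel φ) : HasCompactSupport φ :=
  .of_support_subset_isCompact isCompact_Icc hφ.support

lemma contDiff_deriv (hφ : IsKernel φ) : ContDiff ℝ 1 (deriv φ) :=
  ((contDiff_succ_iff_deriv (n := 1)).1 (by simpa using! hφ.smooth)).2.2

lemma continuous_dd (hφ : IsKernel φ) : Continuous (dd φ) :=
  hφ.contDiff_deriv.continuous_deriv le_rfl

lemma support_dd (hφ : IsKernel φ) : Function.support (dd φ) ⊆ Set.Icc (-1) 1 :=
  support_deriv_subset_Icc (support_deriv_subset_Icc hφ.support)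

lemma integral_dd (hφ : IsKernel φ) : ∫ y, dd φ y = 0 := by
  refine integral_eq_zero_of_hasDerivAt_of_integrable (f := deriv φ) (fun x => ?_) ?_ ?_
  · exact (hφ.contDiff_deriv.differentiable one_ne_zero x).hasDerivAt
  · exact hφ.continuous_dd.integrable_of_hasCompactSupport hφ.hasCompactSupport.deriv.deriv
  · exact hφ.contDiff_deriv.continuous.integrable_of_hasCompactSupport
      hφ.hasCompactSupport.deriv

lemma integral_dd_mul_id (hφ : IsKernel φ) : ∫ y, dd φ y * y = 0 := by
  have hi1 := integrable_kernel_mul hφ.contDiff_deriv.continuous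
    (support_deriv_subset_Icc hφ.support) continuous_id
  have hi0 := hφ.smooth.continuous.integrable_of_hasCompactSupport (μ := volume)
    hφ.hasCompactSupport
  refine integral_eq_zero_of_hasDerivAt_of_integrable
    (f := fun y => deriv φ y * y - φ y) (fun x => ?_) ?_ (hi1.sub hi0)
  · have h1 := (hφ.contDiff_deriv.differentiable one_ne_zero x).hasDerivAt
    have h0 := (hφ.smooth.differentiable two_ne_zero x).hasDerivAt
    convert! (h1.mul (hasDerivAt_id x)).sub h0 using 1
    simp [dd]
  · exact integrable_kernel_mul hφ.continuous_dd hφ.support_dd continuous_id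

lemma integral_abs (hφ : IsKernel φ) : ∫ y, |φ y| = 1 := by
  simpa only [abs_of_nonneg (hφ.nonneg _)] using hφ.integral_one

lemma dd_mollify (hφ : IsKernel φ) {ε : ℝ} (hε : 0 < ε) {f : ℝ → ℝ} (hf : Continuous f)
    (t : ℝ) : dd (mollify φ ε f) t = ε⁻¹ ^ 2 * ∫ y, dd φ y * f (t - ε * y) := by
  rw [dd, deriv_mollify hε (hφ.smooth.of_le one_le_two) hφ.hasCompactSupport hf,
    deriv_const_mul_field, deriv_mollify hε hφ.contDiff_deriv hφ.hasCompactSupport.deriv hf,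
    ← mollify_eq_integral hε]
  simp only [dd]
  ring

lemma integral_dd_mul_sub_const (hφ : IsKernel φ) {f : ℝ → ℝ} (hf : Continuous f) (c : ℝ) :
    ∫ y, dd φ y * (f y - c) = ∫ y, dd φ y * f y := by
  have hi := integrable_kernel_mul hφ.continuous_dd hφ.support_dd hf
  have hic := integrable_kernel_mul hφ.continuous_dd hφ.support_dd (continuous_const (y := c))
  simp only [mul_sub]
  rw [integral_sub hi hic, integral_mul_const, hφ.integral_dd, zero_mul, sub_zero]

end IsKernel

lemma abs_exp_sub_one_le_of_abs_le {x η : ℝ} (hx : |x| ≤ η) (hη : η ≤ 1) :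
    |Real.exp x - 1| ≤ 2 * η :=
  (Real.abs_exp_sub_one_le (hx.trans hη)).trans (by linarith)

section ExponentialWindow

variable {φ h β : ℝ → ℝ} {σ η : ℝ}

lemma abs_integral_kernel_exp_sub_one_le (hφ : IsKernel φ) (hh : Continuous h) (hη : η ≤ 1 / 4)
    (hhη : ∀ y ∈ Set.Icc (-1 : ℝ) 1, |h y| ≤ η) :
    |(∫ y, φ y * Real.exp (h y)) - 1| ≤ 2 * η := by
  have hi := integrable_kernel_mul hφ.smooth.continuous hφ.support hh.rexp
  have hi0 := hφ.smooth.continuous.integrable_of_hasCompactSupport (μ := volume)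
    hφ.hasCompactSupport
  have hb := abs_integral_kernel_mul_le (f := fun y => Real.exp (h y) - 1)
    hφ.smooth.continuous hφ.support
    (fun y hy => abs_exp_sub_one_le_of_abs_le (hhη y hy) (by linarith))
  simp only [mul_sub, mul_one] at hb
  rwa [integral_sub hi hi0, hφ.integral_one, hφ.integral_abs, one_mul] at hb

lemma half_le_integral_kernel_exp (hφ : IsKernel φ) (hh : Continuous h) (hη : η ≤ 1 / 4)
    (hhη : ∀ y ∈ Set.Icc (-1 : ℝ) 1, |h y| ≤ η) :
    1 / 2 ≤ ∫ y, φ y * Real.exp (h y) := by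
  have := (abs_le.1 (abs_integral_kernel_exp_sub_one_le hφ hh hη hhη)).1
  linarith

lemma abs_ratio_sub_le_linear (hφ : IsKernel φ) (hh : Continuous h) (hσ : 0 ≤ σ)
    (hη : η ≤ 1 / 4) (hhη : ∀ y ∈ Set.Icc (-1 : ℝ) 1, |h y| ≤ η)
    (hβη : ∀ y ∈ Set.Icc (-1 : ℝ) 1, |β y| ≤ η) :
    |(∫ y, dd φ y * Real.exp (h y)) / (∫ y, φ y * Real.exp (h y)) - σ * ∫ y, dd φ y * β y|
      ≤ (4 + σ) * (∫ y, |dd φ y|) * η := by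
  have hA := half_le_integral_kernel_exp hφ hh hη hhη
  have hB := abs_integral_kernel_mul_le hφ.continuous_dd hφ.support_dd hβη
  have hD := abs_integral_kernel_mul_le (f := fun y => Real.exp (h y) - 1)
    hφ.continuous_dd hφ.support_dd
    (fun y hy => abs_exp_sub_one_le_of_abs_le (hhη y hy) (by linarith))
  rw [hφ.integral_dd_mul_sub_const hh.rexp] at hD
  set A := ∫ y, φ y * Real.exp (h y)
  set D := ∫ y, dd φ y * Real.exp (h y)
  set B := ∫ y, dd φ y * β y
  set K := ∫ y, |dd φ y|
  have hDA : |D / A| ≤ 4 * K * η := by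
    rw [abs_div, abs_of_pos (by linarith : 0 < A), div_le_iff₀ (by linarith)]
    have : 0 ≤ K * η := (abs_nonneg _).trans hB
    nlinarith
  have hsB : |σ * B| ≤ σ * (K * η) := by
    rw [abs_mul, abs_of_nonneg hσ]
    exact mul_le_mul_of_nonneg_left hB hσ
  calc |D / A - σ * B| ≤ |D / A| + |σ * B| := abs_sub _ _
    _ ≤ (4 + σ) * K * η := by linarith

lemma abs_ratio_sub_le_quadratic (hφ : IsKernel φ) (hh : Continuous h) (hβ : Continuous β)
    (hσ : 0 ≤ σ) (hη : η ≤ 1 / 4) (hhη : ∀ y ∈ Set.Icc (-1 : ℝ) 1, |h y| ≤ η)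
    (hβη : ∀ y ∈ Set.Icc (-1 : ℝ) 1, |β y| ≤ η) {m : ℝ}
    (hhβ : ∀ y ∈ Set.Icc (-1 : ℝ) 1, h y = m * y + σ * β y) :
    |(∫ y, dd φ y * Real.exp (h y)) / (∫ y, φ y * Real.exp (h y)) - σ * ∫ y, dd φ y * β y|
      ≤ (2 + 4 * σ) * (∫ y, |dd φ y|) * η ^ 2 := by
  have hA1 := abs_integral_kernel_exp_sub_one_le hφ hh hη hhη
  have hA := half_le_integral_kernel_exp hφ hh hη hhη
  have hB := abs_integral_kernel_mul_le hφ.continuous_dd hφ.support_dd hβη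
  have hE := abs_integral_kernel_mul_le (f := fun y => Real.exp (h y) - m * y - σ * β y - 1)
    (M := η ^ 2) hφ.continuous_dd hφ.support_dd (fun y hy => by
      have h1 := Real.abs_exp_sub_one_sub_id_le ((hhη y hy).trans (by linarith))
      have h2 : h y ^ 2 ≤ η ^ 2 := sq_le_sq' (abs_le.1 (hhη y hy)).1 (abs_le.1 (hhη y hy)).2
      have h3 := hhβ y hy
      rw [show Real.exp (h y) - m * y - σ * β y - 1 = Real.exp (h y) - 1 - h y by linarith]
      exact h1.trans h2)
  have hi1 := integrable_kernel_mul hφ.continuous_dd hφ.support_dd hh.rexp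
  have hi2 : Integrable fun y => dd φ y * y :=
    integrable_kernel_mul hφ.continuous_dd hφ.support_dd continuous_id
  have hi3 := integrable_kernel_mul hφ.continuous_dd hφ.support_dd hβ
  have hsplit : ∫ y, dd φ y * (Real.exp (h y) - m * y - σ * β y)
      = (∫ y, dd φ y * Real.exp (h y)) - σ * ∫ y, dd φ y * β y := by
    have : ∀ y, dd φ y * (Real.exp (h y) - m * y - σ * β y)
        = dd φ y * Real.exp (h y) - m * (dd φ y * y) - σ * (dd φ y * β y) := fun y => by ring
    have hi12 : Integrable fun y => dd φ y * Real.exp (h y) - m * (dd φ y * y) :=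
      hi1.sub (hi2.const_mul m)
    simp only [this]
    rw [integral_sub hi12 (hi3.const_mul σ), integral_sub hi1 (hi2.const_mul m), integral_const_mul, integral_const_mul,
      hφ.integral_dd_mul_id, mul_zero, sub_zero]
  rw [hφ.integral_dd_mul_sub_const (by fun_prop), hsplit] at hE
  set A := ∫ y, φ y * Real.exp (h y)
  set D := ∫ y, dd φ y * Real.exp (h y)
  set B := ∫ y, dd φ y * β y
  set K := ∫ y, |dd φ y|
  have hApos : 0 < A := by linarith
  have hη0 : 0 ≤ η := (abs_nonneg _).trans (hβη 0 (by simp))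
  have hK : 0 ≤ K := integral_nonneg fun _ => abs_nonneg _
  have hprod : |σ * B * (1 - A)| ≤ σ * (K * η) * (2 * η) := by
    rw [abs_mul, abs_mul, abs_of_nonneg hσ, abs_sub_comm]
    gcongr
  have heq : D / A - σ * B = ((D - σ * B) + σ * B * (1 - A)) / A := by
    field_simp
    ring
  rw [heq, abs_div, abs_of_pos hApos, div_le_iff₀ hApos]
  calc |D - σ * B + σ * B * (1 - A)| ≤ |D - σ * B| + |σ * B * (1 - A)| := abs_add_le _ _
    _ ≤ K * η ^ 2 + σ * (K * η) * (2 * η) := add_le_add hE hprod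
    _ = (2 + 4 * σ) * K * η ^ 2 * (1 / 2) := by ring
    _ ≤ (2 + 4 * σ) * K * η ^ 2 * A := by gcongr

end ExponentialWindow

lemma IsFBM.ae_zero {P : Measure Ω} {H : ℝ} {bH : ℝ → Ω → ℝ} (hbH : IsFBM P H bH)
    (hH : 0 < H) : ∀ᵐ ω ∂P, bH 0 ω = 0 := by
  obtain ⟨v, hv⟩ := hbH.gaussian 1 (fun _ => 0) (fun _ => 1)
  simp only [Finset.univ_unique, Finset.sum_singleton, one_mul] at hv
  have hL : MemLp (bH 0) 2 P := by
    have h := memLp_id_gaussianReal (μ := 0) (v := v) 2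
    rw [← hv] at h
    exact (memLp_map_measure_iff (by fun_prop) (hbH.measurable 0).aemeasurable).1 h
  have h0 : ∫ ω, bH 0 ω * bH 0 ω ∂P = 0 := by
    rw [hbH.covariance]
    simp [fbmCov, Real.zero_rpow (by positivity : 2 * H ≠ 0)]
  have hi : Integrable (fun ω => bH 0 ω * bH 0 ω) P := by
    simpa [sq] using hL.integrable_sq
  filter_upwards [(integral_eq_zero_iff_of_nonneg (fun ω => mul_self_nonneg _) hi).1 h0] with ω hω
  simpa using hω


/-- The exponent of the path of `X`, frozen at its initial value for negative times. -/
def logPath (μ σ : ℝ) (b : ℝ → ℝ) (s : ℝ) : ℝ := μ * max s 0 + σ * b (max s 0)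

section Path

variable {φ b : ℝ → ℝ} {μ σ γ C : ℝ}

lemma continuous_logPath (hb : Continuous b) : Continuous (logPath μ σ b) := by
  unfold logPath
  fun_prop

lemma abs_logPath_sub_le (hσ : 0 ≤ σ) (hC : 0 ≤ C) (hγ0 : 0 ≤ γ) (hγ1 : γ ≤ 1)
    (hol : ∀ s ∈ Set.Icc (-2 : ℝ) 2, ∀ t ∈ Set.Icc (-2 : ℝ) 2, |b t - b s| ≤ C * |t - s| ^ γ)
    {ε s t : ℝ} (hε1 : ε ≤ 1) (ht : t ∈ Set.Icc (0 : ℝ) 1)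
    (hst : |s - t| ≤ ε) :
    |logPath μ σ b s - logPath μ σ b t| ≤ (|μ| + σ * C) * ε ^ γ := by
  have hε0 : 0 ≤ ε := (abs_nonneg _).trans hst
  have hs := abs_le.1 hst
  have hmax : |max s 0 - max t 0| ≤ ε := (abs_max_sub_max_le_abs s t 0).trans hst
  have hmem : max s 0 ∈ Set.Icc (-2 : ℝ) 2 :=
    ⟨by linarith [le_max_right s 0], max_le (by linarith [ht.2]) (by norm_num)⟩
  have hmem' : max t 0 ∈ Set.Icc (-2 : ℝ) 2 :=
    ⟨by linarith [le_max_right t 0], max_le (by linarith [ht.2]) (by norm_num)⟩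
  have h1 : |b (max s 0) - b (max t 0)| ≤ C * ε ^ γ :=
    (hol _ hmem' _ hmem).trans (by gcongr)
  have h2 : ε ≤ ε ^ γ := Real.self_le_rpow_of_le_one hε0 hε1 hγ1
  calc |logPath μ σ b s - logPath μ σ b t|
      = |μ * (max s 0 - max t 0) + σ * (b (max s 0) - b (max t 0))| := by
        unfold logPath
        ring_nf
    _ ≤ |μ| * |max s 0 - max t 0| + σ * |b (max s 0) - b (max t 0)| := by
        refine (abs_add_le _ _).trans_eq ?_
        rw [abs_mul, abs_mul, abs_of_nonneg hσ]
    _ ≤ |μ| * ε ^ γ + σ * (C * ε ^ γ) := by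
        gcongr
        exact hmax.trans h2
    _ = (|μ| + σ * C) * ε ^ γ := by ring

lemma mollify_const_mul_exp {ε : ℝ} (hε : 0 < ε) (ψ g : ℝ → ℝ) (c t : ℝ) :
    mollify ψ ε (fun s => c * Real.exp (g s)) t
      = c * Real.exp (g t) * ∫ y, ψ y * Real.exp (g (t - ε * y) - g t) := by
  rw [mollify_eq_integral hε, ← integral_const_mul]
  congr 1
  funext y
  rw [Real.exp_sub]
  field_simp

lemma exists_pos_forall_mul_rpow_le {L κ : ℝ} (hL : 0 < L) (hκ : 0 < κ) (hγ : 0 < γ) :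
    ∃ ε₀ > 0, ε₀ ≤ 1 ∧ ∀ ε, 0 < ε → ε ≤ ε₀ → L * ε ^ γ ≤ κ := by
  refine ⟨min 1 ((κ / L) ^ γ⁻¹), by positivity, min_le_left _ _, fun ε hε hle => ?_⟩
  have h := Real.rpow_le_rpow hε.le (hle.trans (min_le_right _ _)) hγ.le
  rw [Real.rpow_inv_rpow (by positivity) hγ.ne'] at h
  calc L * ε ^ γ ≤ L * (κ / L) := by gcongr
    _ = κ := by field_simp

lemma exists_bound_mollify_exp_logPath (hφ : IsKernel φ) (hb : Continuous b) (hσ : 0 < σ)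
    (hC : 0 < C) (hγ0 : 0 < γ) (hγ1 : γ ≤ 1)
    (hol : ∀ s ∈ Set.Icc (-2 : ℝ) 2, ∀ t ∈ Set.Icc (-2 : ℝ) 2, |b t - b s| ≤ C * |t - s| ^ γ)
    {x₀ : ℝ} (hx₀ : x₀ ≠ 0) :
    ∃ M > 0, ∃ ε₀ > 0, ε₀ ≤ 1 ∧ ∀ ε : ℝ, 0 < ε → ε ≤ ε₀ → ∀ t ∈ Set.Icc (0 : ℝ) 1,
      let Y := fun s => x₀ * Real.exp (logPath μ σ b s)
      mollify φ ε Y t ≠ 0 ∧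
      |dd (mollify φ ε Y) t / mollify φ ε Y t - σ * dd (mollify φ ε b) t| ≤ M * ε ^ (γ - 2) ∧
      (ε ≤ t → |dd (mollify φ ε Y) t / mollify φ ε Y t - σ * dd (mollify φ ε b) t|
        ≤ M * ε ^ (2 * γ - 2)) := by
  set L := |μ| + σ * C + C
  have hL0 : 0 < L := by positivity
  obtain ⟨ε₀, hε₀, hε₀1, hsmall⟩ :=
    exists_pos_forall_mul_rpow_le hL0 (by norm_num : (0 : ℝ) < 1 / 4) hγ0
  set K := ∫ y, |dd φ y|
  have hK : 0 ≤ K := integral_nonneg fun _ => abs_nonneg _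
  refine ⟨(4 + σ) * K * L + (2 + 4 * σ) * K * L ^ 2 + 1, by positivity, ε₀, hε₀, hε₀1,
    fun ε hε hle t ht => ?_⟩
  intro Y
  have hε1 : ε ≤ 1 := hle.trans hε₀1
  have hη := hsmall ε hε hle
  set g := logPath μ σ b with hg
  have hgc : Continuous g := continuous_logPath hb
  set h : ℝ → ℝ := fun y => g (t - ε * y) - g t with hh
  set β : ℝ → ℝ := fun y => b (t - ε * y) - b t with hβ
  have hhc : Continuous h := by fun_prop
  have hβc : Continuous β := by fun_prop
  have hwin : ∀ y ∈ Set.Icc (-1 : ℝ) 1, |t - ε * y - t| ≤ ε := fun y hy => by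
    rw [show t - ε * y - t = -(ε * y) by ring, abs_neg, abs_mul, abs_of_pos hε]
    exact mul_le_of_le_one_right hε.le (abs_le.2 hy)
  have hhη : ∀ y ∈ Set.Icc (-1 : ℝ) 1, |h y| ≤ L * ε ^ γ := fun y hy => by
    refine (abs_logPath_sub_le hσ.le hC.le hγ0.le hγ1 hol hε1 ht (hwin y hy)).trans ?_
    gcongr
    linarith
  have hβη : ∀ y ∈ Set.Icc (-1 : ℝ) 1, |β y| ≤ L * ε ^ γ := fun y hy => by
    have hy' := abs_le.1 (hwin y hy)
    refine (hol t ⟨by linarith [ht.1], by linarith [ht.2]⟩ (t - ε * y)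
      ⟨by linarith [ht.1], by linarith [ht.2]⟩).trans ?_
    have : C ≤ L := by
      have : 0 ≤ |μ| + σ * C := by positivity
      linarith
    have := hwin y hy
    gcongr
  have hA := half_le_integral_kernel_exp hφ hhc hη hhη
  have hlin := abs_ratio_sub_le_linear hφ hhc hσ.le hη hhη hβη
  have hm : mollify φ ε Y t = x₀ * Real.exp (g t) * ∫ y, φ y * Real.exp (h y) :=
    mollify_const_mul_exp hε φ g x₀ t
  have hddY : dd (mollify φ ε Y) t
      = ε⁻¹ ^ 2 * (x₀ * Real.exp (g t) * ∫ y, dd φ y * Real.exp (h y)) := by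
    rw [hφ.dd_mollify hε (f := Y) (continuous_const.mul hgc.rexp), ← mollify_eq_integral hε, mollify_const_mul_exp hε]
  have hddb : dd (mollify φ ε b) t = ε⁻¹ ^ 2 * ∫ y, dd φ y * β y := by
    rw [hφ.dd_mollify hε hb,
      hφ.integral_dd_mul_sub_const (f := fun y => b (t - ε * y)) (by fun_prop)]
  have hc : x₀ * Real.exp (g t) ≠ 0 := mul_ne_zero hx₀ (Real.exp_pos _).ne'
  have hA0 : (∫ y, φ y * Real.exp (h y)) ≠ 0 := by linarith
  have hratio : dd (mollify φ ε Y) t / mollify φ ε Y t - σ * dd (mollify φ ε b) t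
      = ε⁻¹ ^ 2 * ((∫ y, dd φ y * Real.exp (h y)) / (∫ y, φ y * Real.exp (h y))
        - σ * ∫ y, dd φ y * β y) := by
    rw [hm, hddY, hddb, mul_sub, mul_left_comm σ, mul_div_assoc, mul_div_mul_left _ _ hc]
  have hinv : ε⁻¹ ^ 2 = ε ^ (-2 : ℝ) := by
    rw [Real.rpow_neg hε.le, Real.rpow_two, inv_pow]
  have hscale1 : ε⁻¹ ^ 2 * ε ^ γ = ε ^ (γ - 2) := by
    rw [hinv, ← Real.rpow_add hε]
    ring_nf
  have hscale2 : ε⁻¹ ^ 2 * (ε ^ γ) ^ 2 = ε ^ (2 * γ - 2) := by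
    rw [hinv, sq, ← Real.rpow_add hε, ← Real.rpow_add hε]
    ring_nf
  have hε2 : 0 ≤ ε⁻¹ ^ 2 := by positivity
  refine ⟨hm ▸ mul_ne_zero hc hA0, ?_, fun hεt => ?_⟩
  · rw [hratio, abs_mul, abs_of_nonneg hε2]
    calc _ ≤ ε⁻¹ ^ 2 * ((4 + σ) * K * (L * ε ^ γ)) := mul_le_mul_of_nonneg_left hlin hε2
      _ = (4 + σ) * K * L * ε ^ (γ - 2) := by rw [← hscale1]; ring
      _ ≤ _ := by
        have : 0 ≤ (2 + 4 * σ) * K * L ^ 2 := by positivity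
        gcongr
        linarith
  · have hhβ : ∀ y ∈ Set.Icc (-1 : ℝ) 1, h y = (-(μ * ε)) * y + σ * β y := fun y hy => by
      have hy' := abs_le.1 (hwin y hy)
      simp only [hh, hβ, hg, logPath]
      rw [max_eq_left (by linarith : 0 ≤ t - ε * y), max_eq_left ht.1]
      ring
    have hquad := abs_ratio_sub_le_quadratic hφ hhc hβc hσ.le hη hhη hβη hhβ
    rw [hratio, abs_mul, abs_of_nonneg hε2]
    calc _ ≤ ε⁻¹ ^ 2 * ((2 + 4 * σ) * K * (L * ε ^ γ) ^ 2) :=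
          mul_le_mul_of_nonneg_left hquad hε2
      _ = (2 + 4 * σ) * K * L ^ 2 * ε ^ (2 * γ - 2) := by rw [← hscale2]; ring
      _ ≤ _ := by
        have : 0 ≤ (4 + σ) * K * L := by positivity
        gcongr
        linarith

end Path

/-- Lemma 3.1 for the model `dX = σ X db_H + μ X dt`: the decomposition
`Ẍ_ε(t) = σ X_ε(t) b̈_H^ε(t) + X_ε(t) a_ε(t)` holds on `[0,1]`, with
`|a_ε(t)| ≤ C(ω)(ε^{H-2-δ} 1_{[0,ε]}(t) + ε^{2H-2-δ} 1_{[ε,1]}(t))`. -/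
theorem statement9 (P : Measure Ω) [IsProbabilityMeasure P]
    (H : ℝ) (hH0 : 1/2 < H) (hH1 : H < 1)
    (bH : ℝ → Ω → ℝ) (hbH : IsFBM P H bH)
    (φ : ℝ → ℝ) (hφ : IsKernel φ)
    (σ μ x₀ : ℝ) (hσ : 0 < σ) (hx₀ : x₀ ≠ 0)
    (X : ℝ → Ω → ℝ)
    (hX : ∀ t ω, X t ω = if 0 ≤ t then x₀ * Real.exp (μ * t + σ * bH t ω) else x₀)
    (a : ℝ → Ω → ℝ → ℝ)
    (ha : ∀ ε ω t, a ε ω t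
        = dd (mollify φ ε fun s => X s ω) t / mollify φ ε (fun s => X s ω) t
          - σ * dd (mollify φ ε fun s => bH s ω) t)
    (δ : ℝ) (hδ : 0 < δ) :
    ∀ᵐ ω ∂P, ∃ C > 0, ∃ ε₀ > 0, ∀ ε : ℝ, 0 < ε → ε ≤ ε₀ → ∀ t ∈ Set.Icc (0:ℝ) 1,
      mollify φ ε (fun s => X s ω) t ≠ 0 ∧
      dd (mollify φ ε fun s => X s ω) t
        = σ * mollify φ ε (fun s => X s ω) t * dd (mollify φ ε fun s => bH s ω) t
          + mollify φ ε (fun s => X s ω) t * a ε ω t ∧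
      |a ε ω t| ≤ C * (Set.indicator (Set.Icc 0 ε) (fun _ => ε ^ (H - 2 - δ)) t
          + Set.indicator (Set.Icc ε 1) (fun _ => ε ^ (2 * H - 2 - δ)) t) := by
  set δ' := min (δ / 2) (H / 2)
  have hδ0 : 0 < δ' := lt_min (by linarith) (by linarith)
  have hδδ : δ' ≤ δ / 2 := min_le_left _ _
  have hδH : δ' < H := (min_le_right _ _).trans_lt (by linarith)
  filter_upwards [hbH.cont, hbH.holder δ' hδ0 hδH, hbH.ae_zero (by linarith)]
    with ω hcont hhol hzero
  obtain ⟨C, hC, hol⟩ := hhol 2 two_pos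
  obtain ⟨M, hM, ε₀, hε₀, hε₀1, hbound⟩ := exists_bound_mollify_exp_logPath (μ := μ) hφ hcont hσ
    hC (by linarith : 0 < H - δ') (by linarith) hol hx₀
  have hXY : (fun s => X s ω)
      = fun s => x₀ * Real.exp (logPath μ σ (fun t => bH t ω) s) := by
    funext s
    rw [hX, logPath]
    split_ifs with hs
    · rw [max_eq_left hs]
    · simp [max_eq_right (not_le.1 hs).le, hzero]
  refine ⟨M, hM, ε₀, hε₀, fun ε hε hle t ht => ?_⟩
  obtain ⟨hne, hlin, hquad⟩ := hbound ε hε hle t ht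
  rw [← hXY] at hne hlin hquad
  rw [← ha] at hlin hquad
  have hε1 : ε ≤ 1 := hle.trans hε₀1
  refine ⟨hne, ?_, ?_⟩
  · rw [ha]
    field_simp
    ring
  · have hnonneg : ∀ (S : Set ℝ) (p : ℝ), 0 ≤ S.indicator (fun _ => ε ^ p) t := fun S p =>
      Set.indicator_nonneg (fun _ _ => (Real.rpow_pos_of_pos hε p).le) t
    rcases le_total t ε with hte | hεt
    · refine hlin.trans (mul_le_mul_of_nonneg_left ?_ hM.le)
      refine le_add_of_le_of_nonneg ?_ (hnonneg _ _)
      rw [Set.indicator_of_mem (show t ∈ Set.Icc 0 ε from ⟨ht.1, hte⟩)]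
      exact Real.rpow_le_rpow_of_exponent_ge hε hε1 (by linarith)
    · refine (hquad hεt).trans (mul_le_mul_of_nonneg_left ?_ hM.le)
      refine le_add_of_nonneg_of_le (hnonneg _ _) ?_
      rw [Set.indicator_of_mem (show t ∈ Set.Icc ε 1 from ⟨hεt, ht.2⟩)]
      exact Real.rpow_le_rpow_of_exponent_ge hε hε1 (by linarith)

end FBMPaper
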